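/- arXiv:2509.08153 — 2 statements merged into one kernel-verified Lean document; each statement's English description precedes it below -/
import Mathlib

section
/- Let (F, ω_M, ω_N) be a relative n-plectic structure and let (f, α), (g, β) ∈ Ω^{n−1}_{Ham}(F) be relative Hamiltonian (n−1)-forms with Hamiltonian vector fields (u₁, v₁) and (u₂, v₂). Then the relative semi-bracket {(f,α),(g,β)}_s := (ι_{u₂}ι_{u₁}ω_M, ι_{v₂}ι_{v₁}ω_N) satisfies: (1) skew-symmetry, {(f,α),(g,β)}_s = −{(g,β),(f,α)}_s; and (2) d{(f,α),(g,β)}_s = −ι_{([u₁,u₂],[v₁,v₂])}(ω_M, ω_N), so the semi-bracket of Hamiltonian forms is again Hamiltonian, with Hamiltonian vector field the bracket ([u₁,u₂],[v₁,v₂]). -/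
/-!
STATEMENT 15: Let `(F, ω_M, ω_N)` be a relative `n`-plectic structure and let
`(f, α), (g, β) ∈ Ω^{n−1}_{Ham}(F)` be relative Hamiltonian `(n−1)`-forms with
Hamiltonian vector fields `(u₁, v₁)`, `(u₂, v₂)`.  Then the relative
semi-bracket `{(f,α),(g,β)}_s = (ι_{u₂}ι_{u₁}ω_M, ι_{v₂}ι_{v₁}ω_N)` satisfies
 (1) skew-symmetry: `{(f,α),(g,β)}_s = −{(g,β),(f,α)}_s`;
 (2) `d {(f,α),(g,β)}_s = −ι_{([u₁,u₂],[v₁,v₂])}(ω_M, ω_N)`,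
so the semi-bracket of Hamiltonian forms is again Hamiltonian with
Hamiltonian vector field `([u₁,u₂],[v₁,v₂])`.

Formalization: abstract Cartan-calculus model of the forms on `M` and `N`;
`RelForm ΩM ΩN k` is `Ω^{k+1}(F)`, so with `n = k + 2` the relative plectic
form lives in `RelForm ΩM ΩN (k+2)` and the Hamiltonian `(n−1)`-forms in
`RelForm ΩM ΩN k`.  The hypotheses record the standard Cartan-calculus
identities, the pullback compatibilities, closedness and nondegeneracy of
`(ω_M, ω_N)`, and the Hamiltonian conditions. -/

/-- The operations of Cartan calculus on a graded family `Ω` of differential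
forms with vector fields `VF`. -/
structure CartanCalculus (Ω : ℕ → Type*) (VF : Type*) where
  /-- exterior differential -/
  d : ∀ {n : ℕ}, Ω n → Ω (n + 1)
  /-- interior product -/
  iota : ∀ {n : ℕ}, VF → Ω (n + 1) → Ω n
  /-- Lie derivative -/
  lie : ∀ {n : ℕ}, VF → Ω n → Ω n
  /-- Lie bracket of vector fields -/
  bracket : VF → VF → VF

/-- The standard identities of Cartan calculus. -/
structure CartanFacts {Ω : ℕ → Type*} {VF : Type*} [∀ n, AddCommGroup (Ω n)]
    (C : CartanCalculus Ω VF) : Prop where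
  d_d : ∀ {n : ℕ} (ω : Ω n), C.d (C.d ω) = 0
  d_add : ∀ {n : ℕ} (a b : Ω n), C.d (a + b) = C.d a + C.d b
  iota_add : ∀ {n : ℕ} (X : VF) (a b : Ω (n + 1)),
    C.iota X (a + b) = C.iota X a + C.iota X b
  lie_add : ∀ {n : ℕ} (X : VF) (a b : Ω n),
    C.lie X (a + b) = C.lie X a + C.lie X b
  lie_lie : ∀ {n : ℕ} (X Y : VF) (ω : Ω n),
    C.lie X (C.lie Y ω) - C.lie Y (C.lie X ω) = C.lie (C.bracket X Y) ω
  iota_iota : ∀ {n : ℕ} (X Y : VF) (ω : Ω (n + 2)),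
    C.iota X (C.iota Y ω) + C.iota Y (C.iota X ω) = 0
  d_lie : ∀ {n : ℕ} (X : VF) (ω : Ω n), C.d (C.lie X ω) = C.lie X (C.d ω)
  lie_iota : ∀ {n : ℕ} (X Y : VF) (ω : Ω (n + 1)),
    C.lie X (C.iota Y ω) - C.iota Y (C.lie X ω) = C.iota (C.bracket X Y) ω
  cartan : ∀ {n : ℕ} (X : VF) (ω : Ω (n + 1)),
    C.iota X (C.d ω) + C.d (C.iota X ω) = C.lie X ω

/-- The space of relative `(k+1)`-forms `Ω^{k+1}(F) = Ω^k(M) ⊕ Ω^{k+1}(N)`. -/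
abbrev RelForm (ΩM ΩN : ℕ → Type*) (k : ℕ) := ΩM k × ΩN (k + 1)

section

variable {ΩM ΩN : ℕ → Type*} {VM VN : Type*}
variable [∀ n, AddCommGroup (ΩM n)] [∀ n, AddCommGroup (ΩN n)]

/-- Compatibility of the pullback `F^* = pull` and of `F`-relatedness `Rel`
with the Cartan operations. -/
structure PullFacts (CM : CartanCalculus ΩM VM) (CN : CartanCalculus ΩN VN)
    (pull : ∀ {n : ℕ}, ΩN n → ΩM n) (Rel : VM → VN → Prop) : Prop where
  pull_add : ∀ {n : ℕ} (a b : ΩN n), pull (a + b) = pull a + pull b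
  pull_d : ∀ {n : ℕ} (β : ΩN n), CM.d (pull β) = pull (CN.d β)
  pull_iota : ∀ {n : ℕ} {u : VM} {v : VN}, Rel u v →
    ∀ (β : ΩN (n + 1)), CM.iota u (pull β) = pull (CN.iota v β)
  pull_lie : ∀ {n : ℕ} {u : VM} {v : VN}, Rel u v →
    ∀ (β : ΩN n), CM.lie u (pull β) = pull (CN.lie v β)
  rel_bracket : ∀ {u a : VM} {v b : VN}, Rel u v → Rel a b →
    Rel (CM.bracket u a) (CN.bracket v b)

/-- The relative de Rham differential `d(α, β) = (F^*β + dα, −dβ)`. -/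
def relD (CM : CartanCalculus ΩM VM) (CN : CartanCalculus ΩN VN)
    (pull : ∀ {n : ℕ}, ΩN n → ΩM n) {k : ℕ} (ω : RelForm ΩM ΩN k) :
    RelForm ΩM ΩN (k + 1) :=
  (pull ω.2 + CM.d ω.1, - CN.d ω.2)

/-- The relative interior product `ι_{(u,v)}(α, β) = (ι_u α, −ι_v β)`. -/
def relIota (CM : CartanCalculus ΩM VM) (CN : CartanCalculus ΩN VN)
    (u : VM) (v : VN) {k : ℕ} (ω : RelForm ΩM ΩN (k + 1)) : RelForm ΩM ΩN k :=
  (CM.iota u ω.1, - CN.iota v ω.2)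

/-- The relative Lie derivative `𝓛_{(u,v)}(α, β) = (𝓛_u α, 𝓛_v β)`. -/
def relLie (CM : CartanCalculus ΩM VM) (CN : CartanCalculus ΩN VN)
    (u : VM) (v : VN) {k : ℕ} (ω : RelForm ΩM ΩN k) : RelForm ΩM ΩN k :=
  (CM.lie u ω.1, CN.lie v ω.2)

/-- The relative semi-bracket
`{(f,α),(g,β)}_s = (ι_{u₂}ι_{u₁}ω_M, ι_{v₂}ι_{v₁}ω_N)`, where `(u₁,v₁)` and
`(u₂,v₂)` are the Hamiltonian vector fields of the two Hamiltonian forms and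
`(ω_M, ω_N)` is the relative plectic form. -/
def semiBracket (CM : CartanCalculus ΩM VM) (CN : CartanCalculus ΩN VN)
    (u₁ u₂ : VM) (v₁ v₂ : VN) {k : ℕ} (Ω : RelForm ΩM ΩN (k + 2)) :
    RelForm ΩM ΩN k :=
  (CM.iota u₂ (CM.iota u₁ Ω.1), CN.iota v₂ (CN.iota v₁ Ω.2))

namespace CartanFacts

variable {Ω : ℕ → Type*} {VF : Type*} [∀ n, AddCommGroup (Ω n)] {C : CartanCalculus Ω VF}

theorem d_zero (hC : CartanFacts C) {n : ℕ} : C.d (0 : Ω n) = 0 := by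
  simpa using hC.d_add (0 : Ω n) 0

theorem d_neg (hC : CartanFacts C) {n : ℕ} (a : Ω n) : C.d (-a) = -C.d a := by
  rw [eq_neg_iff_add_eq_zero, ← hC.d_add, neg_add_cancel, hC.d_zero]

theorem iota_zero (hC : CartanFacts C) {n : ℕ} (X : VF) : C.iota X (0 : Ω (n + 1)) = 0 := by
  simpa using hC.iota_add X (0 : Ω (n + 1)) 0

theorem iota_neg (hC : CartanFacts C) {n : ℕ} (X : VF) (a : Ω (n + 1)) :
    C.iota X (-a) = -C.iota X a := by
  rw [eq_neg_iff_add_eq_zero, ← hC.iota_add, neg_add_cancel, hC.iota_zero]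

theorem iota_iota_comm (hC : CartanFacts C) {n : ℕ} (X Y : VF) (ω : Ω (n + 2)) :
    C.iota X (C.iota Y ω) = -C.iota Y (C.iota X ω) :=
  eq_neg_of_add_eq_zero_left (hC.iota_iota X Y ω)

/-- If `X` and `Y` preserve `ω`, then
`ι_{[X,Y]} ω = −d ι_Y ι_X ω − ι_X ι_Y dω`. -/
theorem iota_bracket_of_lie_eq_zero (hC : CartanFacts C) {n : ℕ} {X Y : VF} {ω : Ω (n + 2)}
    (hX : C.lie X ω = 0) (hY : C.lie Y ω = 0) :
    C.iota (C.bracket X Y) ω =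
      -C.d (C.iota Y (C.iota X ω)) - C.iota X (C.iota Y (C.d ω)) := by
  have hd : C.d (C.iota Y ω) = -C.iota Y (C.d ω) :=
    eq_neg_of_add_eq_zero_right ((hC.cartan Y ω).trans hY)
  rw [← hC.lie_iota, hX, hC.iota_zero, sub_zero, ← hC.cartan, hd, hC.iota_neg,
    hC.iota_iota_comm X Y ω, hC.d_neg, neg_add_eq_sub]

end CartanFacts

namespace PullFacts

variable {CM : CartanCalculus ΩM VM} {CN : CartanCalculus ΩN VN}
variable {pull : ∀ {n : ℕ}, ΩN n → ΩM n} {Rel : VM → VN → Prop}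

theorem pull_zero (hP : PullFacts CM CN pull Rel) {n : ℕ} : pull (0 : ΩN n) = 0 := by
  simpa using hP.pull_add (0 : ΩN n) 0

theorem pull_neg (hP : PullFacts CM CN pull Rel) {n : ℕ} (a : ΩN n) :
    pull (-a) = -pull a := by
  rw [eq_neg_iff_add_eq_zero, ← hP.pull_add, neg_add_cancel, hP.pull_zero]

end PullFacts

/-- The Hamiltonian pair of a relative Hamiltonian form preserves a closed relative form. -/
theorem relLie_eq_zero_of_hamiltonian
    {CM : CartanCalculus ΩM VM} {CN : CartanCalculus ΩN VN}
    {pull : ∀ {n : ℕ}, ΩN n → ΩM n} {Rel : VM → VN → Prop}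
    (hM : CartanFacts CM) (hN : CartanFacts CN) (hP : PullFacts CM CN pull Rel)
    {k : ℕ} {Ω : RelForm ΩM ΩN (k + 2)} (hclosed : relD CM CN pull Ω = 0)
    {fα : RelForm ΩM ΩN k} {u : VM} {v : VN} (h : Rel u v)
    (hham : relD CM CN pull fα = -relIota CM CN u v Ω) :
    relLie CM CN u v Ω = 0 := by
  have hdM : CM.d Ω.1 = -pull Ω.2 := eq_neg_of_add_eq_zero_right (congrArg Prod.fst hclosed)
  have hdN : CN.d Ω.2 = 0 := neg_eq_zero.mp (congrArg Prod.snd hclosed)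
  have hα : pull fα.2 + CM.d fα.1 = -CM.iota u Ω.1 := congrArg Prod.fst hham
  have hβ : CN.d fα.2 = -CN.iota v Ω.2 := neg_injective (congrArg Prod.snd hham)
  have hu : CM.iota u Ω.1 = -(pull fα.2 + CM.d fα.1) := by rw [hα, neg_neg]
  have hv : CN.iota v Ω.2 = -CN.d fα.2 := by rw [hβ, neg_neg]
  refine Prod.ext ?_ ?_
  · change CM.lie u Ω.1 = 0
    rw [← hM.cartan, hdM, hu, hM.iota_neg, hM.d_neg, hM.d_add, hM.d_d, hP.pull_iota h, hv,
      hP.pull_neg, hP.pull_d]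
    abel
  · change CN.lie v Ω.2 = 0
    rw [← hN.cartan, hdN, hv, hN.iota_zero, hN.d_neg, hN.d_d, neg_zero, add_zero]

theorem relative_semi_bracket_skew_and_hamiltonian
    [AddCommGroup VM] [AddCommGroup VN]
    (CM : CartanCalculus ΩM VM) (CN : CartanCalculus ΩN VN)
    (pull : ∀ {n : ℕ}, ΩN n → ΩM n)
    (Rel : VM → VN → Prop)
    (hM : CartanFacts CM) (hN : CartanFacts CN)
    (hP : PullFacts CM CN pull Rel)
    -- the relative `(k+2)`-plectic structure
    {k : ℕ} (Ω : RelForm ΩM ΩN (k + 2))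
    (hclosed : relD CM CN pull Ω = 0)
    (hnondeg : ∀ (u : VM) (v : VN), Rel u v →
      relIota CM CN u v Ω = 0 → u = 0 ∧ v = 0)
    -- two relative Hamiltonian `(n−1)`-forms with their Hamiltonian pairs
    (fα gβ : RelForm ΩM ΩN k)
    (u₁ u₂ : VM) (v₁ v₂ : VN)
    (h₁ : Rel u₁ v₁) (h₂ : Rel u₂ v₂)
    (hham₁ : relD CM CN pull fα = - relIota CM CN u₁ v₁ Ω)
    (hham₂ : relD CM CN pull gβ = - relIota CM CN u₂ v₂ Ω) :
    -- (1) skew-symmetry of the semi-bracket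
    semiBracket CM CN u₁ u₂ v₁ v₂ Ω = - semiBracket CM CN u₂ u₁ v₂ v₁ Ω
    ∧
    -- (2) the semi-bracket is Hamiltonian with vector field the pair bracket
    relD CM CN pull (semiBracket CM CN u₁ u₂ v₁ v₂ Ω)
      = - relIota CM CN (CM.bracket u₁ u₂) (CN.bracket v₁ v₂) Ω := by
  have hdM : CM.d Ω.1 = -pull Ω.2 := eq_neg_of_add_eq_zero_right (congrArg Prod.fst hclosed)
  have hdN : CN.d Ω.2 = 0 := neg_eq_zero.mp (congrArg Prod.snd hclosed)
  have hL₁ := relLie_eq_zero_of_hamiltonian hM hN hP hclosed h₁ hham₁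
  have hL₂ := relLie_eq_zero_of_hamiltonian hM hN hP hclosed h₂ hham₂
  refine ⟨Prod.ext (hM.iota_iota_comm _ _ _) (hN.iota_iota_comm _ _ _), Prod.ext ?_ ?_⟩
  · change pull (CN.iota v₂ (CN.iota v₁ Ω.2)) + CM.d (CM.iota u₂ (CM.iota u₁ Ω.1)) =
      -CM.iota (CM.bracket u₁ u₂) Ω.1
    rw [hM.iota_bracket_of_lie_eq_zero (congrArg Prod.fst hL₁) (congrArg Prod.fst hL₂), hdM,
      hM.iota_neg, hM.iota_neg, hP.pull_iota h₂, hP.pull_iota h₁, hN.iota_iota_comm v₁ v₂,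
      hP.pull_neg]
    abel
  · change -CN.d (CN.iota v₂ (CN.iota v₁ Ω.2)) = - -CN.iota (CN.bracket v₁ v₂) Ω.2
    rw [hN.iota_bracket_of_lie_eq_zero (congrArg Prod.snd hL₁) (congrArg Prod.snd hL₂), hdN,
      hN.iota_zero, hN.iota_zero, sub_zero, neg_neg]

end
end

section
/- Let (F, ω_M, ω_N) be a relative n-plectic structure and let (f, α), (g, β) ∈ Ω^{n−1}_{Ham}(F) be relative Hamiltonian (n−1)-forms with Hamiltonian vector fields (u₁, v₁) and (u₂, v₂). Define the alternator S((f,α),(g,β)) := −(ι_{(u₁,v₁)}(g,β) + ι_{(u₂,v₂)}(f,α)). Then the hemi-bracket is skew-symmetric up to the exact term dS: {(f,α),(g,β)}_h + d S((f,α),(g,β)) = −{(g,β),(f,α)}_h. -/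
section

variable {ΩM ΩN : ℕ → Type*} {VM VN : Type*}
variable [∀ n, AddCommGroup (ΩM n)] [∀ n, AddCommGroup (ΩN n)]

section Helpers

/-- An additive map between additive groups commutes with negation. -/
theorem map_neg_of_add {A B : Type*} [AddCommGroup A] [AddCommGroup B] {φ : A → B}
    (h : ∀ a b, φ (a + b) = φ a + φ b) (a : A) : φ (-a) = -φ a :=
  map_neg (AddMonoidHom.mk' φ h) a

variable {CM : CartanCalculus ΩM VM} {CN : CartanCalculus ΩN VN}
  {pull : ∀ {n : ℕ}, ΩN n → ΩM n} {Rel : VM → VN → Prop}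

theorem relD_add (hM : CartanFacts CM) (hN : CartanFacts CN)
    (hP : PullFacts CM CN pull Rel) {k : ℕ} (a b : RelForm ΩM ΩN k) :
    relD CM CN pull (a + b) = relD CM CN pull a + relD CM CN pull b := by
  ext
  · simp only [relD, Prod.fst_add, Prod.snd_add, hP.pull_add, hM.d_add]
    abel
  · simp only [relD, Prod.snd_add, hN.d_add]
    abel

theorem relIota_add (hM : CartanFacts CM) (hN : CartanFacts CN) (u : VM) (v : VN) {k : ℕ}
    (a b : RelForm ΩM ΩN (k + 1)) :
    relIota CM CN u v (a + b) = relIota CM CN u v a + relIota CM CN u v b := by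
  ext
  · simp only [relIota, Prod.fst_add, hM.iota_add]
  · simp only [relIota, Prod.snd_add, hN.iota_add]
    abel

/-- Relative interior products anticommute. -/
theorem relIota_relIota (hM : CartanFacts CM) (hN : CartanFacts CN) (u₁ u₂ : VM) (v₁ v₂ : VN)
    {k : ℕ} (ω : RelForm ΩM ΩN (k + 2)) :
    relIota CM CN u₁ v₁ (relIota CM CN u₂ v₂ ω) +
      relIota CM CN u₂ v₂ (relIota CM CN u₁ v₁ ω) = 0 := by
  ext
  · exact hM.iota_iota u₁ u₂ ω.1
  · simpa only [relIota, Prod.snd_add, Prod.snd_zero, map_neg_of_add (hN.iota_add _), neg_neg]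
      using hN.iota_iota v₁ v₂ ω.2

/-- Cartan's formula for relative forms. -/
theorem relLie_eq (hM : CartanFacts CM) (hN : CartanFacts CN)
    (hP : PullFacts CM CN pull Rel) {u : VM} {v : VN} (h : Rel u v) {k : ℕ}
    (ω : RelForm ΩM ΩN (k + 1)) :
    relLie CM CN u v ω =
      relIota CM CN u v (relD CM CN pull ω) + relD CM CN pull (relIota CM CN u v ω) := by
  ext
  · simp only [relLie, relIota, relD, Prod.fst_add, ← hM.cartan, hM.iota_add, hP.pull_iota h,
      map_neg_of_add hP.pull_add]
    abel
  · simp only [relLie, relIota, relD, Prod.snd_add, ← hN.cartan,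
      map_neg_of_add (hN.iota_add _), map_neg_of_add hN.d_add, neg_neg]

end Helpers

theorem relative_hemi_bracket_skew_up_to_alternator
    [AddCommGroup VM] [AddCommGroup VN]
    (CM : CartanCalculus ΩM VM) (CN : CartanCalculus ΩN VN)
    (pull : ∀ {n : ℕ}, ΩN n → ΩM n)
    (Rel : VM → VN → Prop)
    (hM : CartanFacts CM) (hN : CartanFacts CN)
    (hP : PullFacts CM CN pull Rel)
    -- the relative `(k+3)`-plectic structure
    {k : ℕ} (Ω : RelForm ΩM ΩN (k + 3))
    (hclosed : relD CM CN pull Ω = 0)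
    (hnondeg : ∀ (u : VM) (v : VN), Rel u v →
      relIota CM CN u v Ω = 0 → u = 0 ∧ v = 0)
    -- two relative Hamiltonian `(n−1)`-forms with their Hamiltonian pairs
    (fα gβ : RelForm ΩM ΩN (k + 1))
    (u₁ u₂ : VM) (v₁ v₂ : VN)
    (h₁ : Rel u₁ v₁) (h₂ : Rel u₂ v₂)
    (hham₁ : relD CM CN pull fα = - relIota CM CN u₁ v₁ Ω)
    (hham₂ : relD CM CN pull gβ = - relIota CM CN u₂ v₂ Ω) :
    -- `{(f,α),(g,β)}_h + d S((f,α),(g,β)) = −{(g,β),(f,α)}_h`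
    relLie CM CN u₁ v₁ gβ
      + relD CM CN pull
          (- (relIota CM CN u₁ v₁ gβ + relIota CM CN u₂ v₂ fα))
      = - relLie CM CN u₂ v₂ fα := by
  rw [relLie_eq hM hN hP h₁, relLie_eq hM hN hP h₂, hham₁, hham₂,
    map_neg_of_add (relD_add hM hN hP), relD_add hM hN hP,
    map_neg_of_add (relIota_add hM hN u₁ v₁), map_neg_of_add (relIota_add hM hN u₂ v₂),
    eq_neg_of_add_eq_zero_left (relIota_relIota hM hN u₁ u₂ v₁ v₂ Ω)]
  abel

end
end
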